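/- arXiv:1712.01026 — 2 statements merged into one kernel-verified Lean document; each statement's English description precedes it below -/
import Mathlib

section
/- Let d ≥ 1, let Ω ⊆ ℝ^d be an open, bounded, connected nonempty set, let P, Q, μ be Borel probability measures on ℝ^d, and let p > 0 with p ≠ 1 and k > 0. If there exists an admissible function f₀ with ∫ f₀ dP ≠ ∫ f₀ dQ, then there exists an admissible function f with L_{P,Q,μ,p,k}(f) < 0. (This is the backward direction of the identity-of-indiscernibles part of Theorem 1, proved by rescaling f₀ or −f₀ by a suitable λ > 0.) -/
open MeasureTheory

/-- A function `f : ℝ^d → ℝ` is admissible for `Ω` if it is C¹ and has compact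
support contained in `Ω`. -/
def Admissible {d : ℕ} (Ω : Set (EuclideanSpace ℝ (Fin d)))
    (f : EuclideanSpace ℝ (Fin d) → ℝ) : Prop :=
  ContDiff ℝ 1 f ∧ HasCompactSupport f ∧ tsupport f ⊆ Ω

/-- The Wasserstein-divergence objective
`L_{P,Q,μ,p,k}(f) = ∫ f dP − ∫ f dQ + k ∫ ‖Df(x)‖^p dμ(x)`. -/
noncomputable def Lobj {d : ℕ} (P Q μ : Measure (EuclideanSpace ℝ (Fin d)))
    (p k : ℝ) (f : EuclideanSpace ℝ (Fin d) → ℝ) : ℝ :=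
  ∫ x, f x ∂P - ∫ x, f x ∂Q + k * ∫ x, ‖fderiv ℝ f x‖ ^ p ∂μ

theorem Admissible.const_mul {d : ℕ} {Ω : Set (EuclideanSpace ℝ (Fin d))}
    {f : EuclideanSpace ℝ (Fin d) → ℝ} (hf : Admissible Ω f) (c : ℝ) :
    Admissible Ω (fun x => c * f x) :=
  ⟨contDiff_const.mul hf.1, hf.2.1.mul_left,
    (tsupport_mul_subset_right (f := fun _ => c) (g := f)).trans hf.2.2⟩

theorem Lobj_const_mul {d : ℕ} (P Q μ : Measure (EuclideanSpace ℝ (Fin d))) (p k c : ℝ)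
    {f : EuclideanSpace ℝ (Fin d) → ℝ} (hf : Differentiable ℝ f) :
    Lobj P Q μ p k (fun x => c * f x) =
      c * (∫ x, f x ∂P - ∫ x, f x ∂Q) + k * (|c| ^ p * ∫ x, ‖fderiv ℝ f x‖ ^ p ∂μ) := by
  have h : ∀ x, ‖fderiv ℝ (fun y => c * f y) x‖ ^ p = |c| ^ p * ‖fderiv ℝ f x‖ ^ p := by
    intro x
    rw [fderiv_const_mul (hf x), norm_smul, Real.norm_eq_abs,
      Real.mul_rpow (abs_nonneg c) (norm_nonneg _)]
  simp only [Lobj, h, integral_const_mul]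
  ring

/-- For `p ≠ 1`, the power `t ^ p` is dominated by a linear term at a suitable scale. -/
theorem exists_pos_mul_rpow_lt_mul {a C p : ℝ} (ha : 0 < a) (hC : 0 ≤ C) (hp : p ≠ 1) :
    ∃ t : ℝ, 0 < t ∧ C * t ^ p < a * t := by
  have hs : 0 < a / (C + 1) := by positivity
  refine ⟨(a / (C + 1)) ^ (p - 1)⁻¹, Real.rpow_pos_of_pos hs _, ?_⟩
  set t := (a / (C + 1)) ^ (p - 1)⁻¹ with ht
  have ht0 : 0 < t := Real.rpow_pos_of_pos hs _
  have hpow : t ^ (p - 1) = a / (C + 1) := Real.rpow_inv_rpow hs.le (sub_ne_zero.mpr hp)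
  have hsplit : t ^ p = a / (C + 1) * t := by
    rw [← hpow, ← Real.rpow_add_one ht0.ne', sub_add_cancel]
  have hlt : C * (a / (C + 1)) < a := by
    rw [← mul_div_assoc, div_lt_iff₀ (by positivity)]
    nlinarith
  rw [hsplit, ← mul_assoc]
  exact mul_lt_mul_of_pos_right hlt ht0

theorem stmt1 {d : ℕ} (hd : 1 ≤ d) (Ω : Set (EuclideanSpace ℝ (Fin d)))
    (hΩopen : IsOpen Ω) (hΩbdd : Bornology.IsBounded Ω)
    (hΩconn : IsConnected Ω) (hΩne : Ω.Nonempty)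
    (P Q μ : Measure (EuclideanSpace ℝ (Fin d)))
    [IsProbabilityMeasure P] [IsProbabilityMeasure Q] [IsProbabilityMeasure μ]
    (p k : ℝ) (hp : 0 < p) (hp1 : p ≠ 1) (hk : 0 < k)
    (hsep : ∃ f₀, Admissible Ω f₀ ∧ ∫ x, f₀ x ∂P ≠ ∫ x, f₀ x ∂Q) :
    ∃ f, Admissible Ω f ∧ Lobj P Q μ p k f < 0 := by
  obtain ⟨f, hf, hne⟩ := hsep
  have hdiff : Differentiable ℝ f := hf.1.differentiable one_ne_zero
  have hB : 0 ≤ ∫ x, ‖fderiv ℝ f x‖ ^ p ∂μ :=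
    integral_nonneg fun x => Real.rpow_nonneg (norm_nonneg _) p
  obtain ⟨t, ht, hlt⟩ := exists_pos_mul_rpow_lt_mul (abs_pos.mpr (sub_ne_zero.mpr hne))
    (mul_nonneg hk.le hB) hp1
  rcases lt_or_gt_of_ne hne with h | h
  · refine ⟨_, hf.const_mul t, ?_⟩
    rw [Lobj_const_mul P Q μ p k t hdiff, abs_of_pos ht]
    rw [abs_of_neg (sub_neg.mpr h)] at hlt
    linarith
  · refine ⟨_, hf.const_mul (-t), ?_⟩
    rw [Lobj_const_mul P Q μ p k (-t) hdiff, abs_neg, abs_of_pos ht]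
    rw [abs_of_pos (sub_pos.mpr h)] at hlt
    linarith
end

section
/- Let d ≥ 1, let Ω ⊆ ℝ^d be a nonempty open bounded set, let n₀ > 0 and k > 0, and let μ be a Borel probability measure on ℝ^d such that μ(U) > 0 for every nonempty open U ⊆ Ω (for example, normalized Lebesgue measure on Ω). Then for every continuously differentiable f : ℝ^d → ℝ with compact support contained in Ω, one has k ∫ (‖Df(x)‖ − n₀)² dμ(x) > 0. In particular, when the real and fake distributions coincide (P_r = P_g), the objective W''_{2,k,n₀} of Eq. (15) is strictly positive at every admissible f, so its value 0 is never attained; hence W''_{2,k,n₀} fails the identity axiom of a divergence. -/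
open MeasureTheory

/-- A compactly supported function on a normed space whose support lies in a nonempty set `s`
has a critical point in `s`. -/
theorem HasCompactSupport.exists_mem_fderiv_eq_zero {E : Type*} [NormedAddCommGroup E]
    [NormedSpace ℝ E] {f : E → ℝ} {s : Set E} (hf : HasCompactSupport f) (hc : Continuous f)
    (hs : s.Nonempty) (hfs : tsupport f ⊆ s) : ∃ x ∈ s, fderiv ℝ f x = 0 := by
  obtain ⟨a, ha⟩ := hc.exists_forall_ge_of_hasCompactSupport hf
  obtain ⟨b, hb⟩ := hc.exists_forall_le_of_hasCompactSupport hf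
  by_cases has : a ∈ s
  · exact ⟨a, has, IsLocalMax.fderiv_eq_zero (Filter.Eventually.of_forall ha)⟩
  by_cases hbs : b ∈ s
  · exact ⟨b, hbs, IsLocalMin.fderiv_eq_zero (Filter.Eventually.of_forall hb)⟩
  have ha0 : f a = 0 := image_eq_zero_of_notMem_tsupport fun h => has (hfs h)
  have hb0 : f b = 0 := image_eq_zero_of_notMem_tsupport fun h => hbs (hfs h)
  have hf0 : f = fun _ => 0 := by
    funext x
    exact le_antisymm (ha0 ▸ ha x) (hb0 ▸ hb x)
  obtain ⟨x, hx⟩ := hs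
  exact ⟨x, hx, by simp [hf0]⟩

theorem stmt11 {d : ℕ} (hd : 1 ≤ d) (Ω : Set (EuclideanSpace ℝ (Fin d)))
    (hΩopen : IsOpen Ω) (hΩbdd : Bornology.IsBounded Ω) (hΩne : Ω.Nonempty)
    (n₀ k : ℝ) (hn₀ : 0 < n₀) (hk : 0 < k)
    (μ : Measure (EuclideanSpace ℝ (Fin d))) [IsProbabilityMeasure μ]
    (hμ : ∀ U : Set (EuclideanSpace ℝ (Fin d)),
      U ⊆ Ω → IsOpen U → U.Nonempty → 0 < μ U) :
    ∀ f : EuclideanSpace ℝ (Fin d) → ℝ,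
      ContDiff ℝ 1 f → HasCompactSupport f → tsupport f ⊆ Ω →
      0 < k * ∫ x, (‖fderiv ℝ f x‖ - n₀) ^ 2 ∂μ := by
  intro f hf hfc hfs
  have hD : Continuous (fderiv ℝ f) := hf.continuous_fderiv one_ne_zero
  have hcont : Continuous fun x => (‖fderiv ℝ f x‖ - n₀) ^ 2 := by fun_prop
  have hint : Integrable (fun x => (‖fderiv ℝ f x‖ - n₀) ^ 2) μ := by
    obtain ⟨C, hC⟩ := hD.bounded_above_of_compact_support (hfc.fderiv (𝕜 := ℝ))
    refine Integrable.of_bound hcont.aestronglyMeasurable ((C + n₀) ^ 2)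
      (Filter.Eventually.of_forall fun x => ?_)
    rw [Real.norm_eq_abs, abs_of_nonneg (sq_nonneg _)]
    have := norm_nonneg (fderiv ℝ f x)
    exact sq_le_sq' (by linarith [hC x]) (by linarith [hC x])
  refine mul_pos hk ((integral_pos_iff_support_of_nonneg (fun x => sq_nonneg _) hint).2 ?_)
  obtain ⟨x, hxΩ, hx⟩ := hfc.exists_mem_fderiv_eq_zero hf.continuous hΩne hfs
  refine (hμ (Ω ∩ Function.support fun x => (‖fderiv ℝ f x‖ - n₀) ^ 2) Set.inter_subset_left
    (hΩopen.inter hcont.isOpen_support) ⟨x, hxΩ, ?_⟩).trans_le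
    (measure_mono Set.inter_subset_right)
  simp [hx, hn₀.ne']
end
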